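/- Let m > n be positive integers and let P ∈ D_{m,n}. Then rr(comp(P), m) ≤ ret(P) and rr(comp(P), m) ≤ run(P), i.e., min{ Iones(comp(P)) + 1, ⌈ n/(m−n) ⌉ } ≤ min{ ret(P), run(P) }. -/

import Mathlib

open scoped Classical

namespace RationalDyck

/-- A lattice path: `true` = a north step `N`, `false` = an east step `E`. -/
abbrev Path : Type := List Bool

/-- The rank of the endpoint of a path prefix `Q` in the `m × n` grid:
`rank(i,j) = j*m - i*n`, where `i` is the number of east steps of `Q`
and `j` the number of north steps of `Q`. -/
def prefRank (m n : ℕ) (Q : Path) : ℤ :=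
  (Q.count true : ℤ) * m - (Q.count false : ℤ) * n

/-- `P` is an `m × n` rational Dyck path: it goes from `(0,0)` to `(m,n)` and
stays weakly above the line `y = n x / m`. -/
def IsDyck (m n : ℕ) (P : Path) : Prop :=
  P.count false = m ∧ P.count true = n ∧ ∀ i ≤ P.length, 0 ≤ prefRank m n (P.take i)

/-- The return statistic: the number of lattice points on `P` other than `(m,n)`
whose rank is strictly less than `n`. -/
def retStat (m n : ℕ) (P : Path) : ℕ :=
  ((List.range P.length).filter fun i => prefRank m n (P.take i) < (n : ℤ)).length

/-- The coarea sequence of `P`: for each north step (from bottom to top), the number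
of cells of the rectangle strictly to its left, i.e. the number of east steps before it. -/
def coarea (P : Path) : List ℕ :=
  (List.range P.length).filterMap fun i =>
    if P.getD i false = true then some ((P.take i).count false) else none

/-- The run statistic: the least `i ∈ [n]` not appearing in the coarea sequence. -/
noncomputable def runStat (P : Path) : ℕ :=
  sInf {i : ℕ | 1 ≤ i ∧ i ≤ P.count true ∧ i ∉ coarea P}

/-- The ratio-run statistic: with `k = ⌊m/n⌋`, the least `i ∈ [n]` such that `k*i`
does not appear in the coarea sequence. -/
noncomputable def ratioRun (m n : ℕ) (P : Path) : ℕ :=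
  sInf {i : ℕ | 1 ≤ i ∧ i ≤ P.count true ∧ (m / n) * i ∉ coarea P}

/-- The composition type of `P`: the lengths of the maximal blocks of consecutive
north steps, read from start to end. -/
def compType (P : Path) : List ℕ :=
  ((P.splitOn false).map List.length).filter fun x => x ≠ 0

/-- The number of maximal blocks of consecutive north steps (vertical components). -/
def nc (P : Path) : ℕ := (compType P).length

/-- `α` is a (strong) composition of `n`. -/
def IsComposition (n : ℕ) (α : List ℕ) : Prop :=
  (∀ a ∈ α, 0 < a) ∧ α.sum = n

/-- The finite set of all `m × n` rational Dyck paths. -/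
noncomputable def dyckPaths (m n : ℕ) : Finset Path :=
  ((Finset.univ : Finset (Fin (m + n) → Bool)).image List.ofFn).filter fun P => IsDyck m n P

/-- The `m × n` rational Dyck paths of composition type `α`. -/
noncomputable def dyckPathsComp (m n : ℕ) (α : List ℕ) : Finset Path :=
  (dyckPaths m n).filter fun P => compType P = α

/-- The `m × n` rational Dyck paths with `run = k` and `ret = l`. -/
noncomputable def dyckPathsRR (m n k l : ℕ) : Finset Path :=
  (dyckPaths m n).filter fun P => runStat P = k ∧ retStat m n P = l

/-- The `m × n` rational Dyck paths of composition type `α` with `run = k` and `ret = l`. -/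
noncomputable def dyckPathsCompRR (m n : ℕ) (α : List ℕ) (k l : ℕ) : Finset Path :=
  (dyckPathsComp m n α).filter fun P => runStat P = k ∧ retStat m n P = l

/-- The number of initial parts of `α` equal to `1`. -/
def iones (α : List ℕ) : ℕ := (α.takeWhile fun a => a = 1).length

/-- `rr(α, m) = min(Iones(α) + 1, ⌈n/(m-n)⌉)` where `n = |α|` is the sum of parts. -/
def rr (m : ℕ) (α : List ℕ) : ℕ :=
  min (iones α + 1) ((α.sum + (m - α.sum) - 1) / (m - α.sum))


theorem splitOn_false_cons (b : Bool) (P : Path) :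
    (b :: P).splitOn false =
      if b then (P.splitOn false).modifyHead (List.cons true) else [] :: P.splitOn false := by
  cases b <;> simp [List.splitOn, List.splitOnP_cons_eq_if_modifyHead]

theorem exists_splitOn_false_eq_cons (P : Path) : ∃ B L, P.splitOn false = B :: L :=
  List.exists_cons_of_ne_nil (List.splitOnP_ne_nil _ P)

theorem compType_true_false (Q : Path) :
    compType (true :: false :: Q) = 1 :: compType Q := by
  simp [compType, splitOn_false_cons]

theorem sum_compType (P : Path) : (compType P).sum = P.count true := by
  have sum_filter (l : List ℕ) : (l.filter fun x => x ≠ 0).sum = l.sum := by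
    induction l with
    | nil => rfl
    | cons a l ih => by_cases h : a = 0 <;> simp_all
  rw [compType, sum_filter]
  induction P with
  | nil => simp
  | cons b P ih =>
    obtain ⟨B, L, h⟩ := exists_splitOn_false_eq_cons P
    cases b <;> simp [splitOn_false_cons, h] at ih ⊢ <;> omega

theorem iones_compType_true_true (Q : Path) : iones (compType (true :: true :: Q)) = 0 := by
  obtain ⟨B, L, h⟩ := exists_splitOn_false_eq_cons Q
  simp [iones, compType, splitOn_false_cons, h]

/-- The path `(NE)^i`. -/
def zigzag (i : ℕ) : Path := (List.replicate i [true, false]).flatten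

theorem zigzag_succ (i : ℕ) : zigzag (i + 1) = zigzag i ++ [true, false] := by
  simp [zigzag, List.replicate_succ']

theorem length_zigzag (i : ℕ) : (zigzag i).length = 2 * i := by
  simp [zigzag, mul_comm]

theorem count_zigzag (b : Bool) (i : ℕ) : (zigzag i).count b = i := by
  induction i with
  | zero => simp [zigzag]
  | succ i ih => cases b <;> simp [zigzag_succ, ih]

theorem iones_compType_zigzag_append (i : ℕ) (Q : Path) :
    iones (compType (zigzag i ++ Q)) = i + iones (compType Q) := by
  induction i generalizing Q with
  | zero => simp [zigzag]
  | succ i ih =>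
    rw [zigzag_succ, List.append_assoc, ih]
    simp [compType_true_false, iones]
    omega

theorem coarea_append_singleton (P : Path) (b : Bool) :
    coarea (P ++ [b]) = coarea P ++ if b then [P.count false] else [] := by
  unfold coarea
  rw [List.length_append, List.length_singleton, List.range_succ, List.filterMap_append]
  congr 1
  · apply List.filterMap_congr
    intro i hi
    rw [List.mem_range] at hi
    simp [List.getElem?_append_left hi, List.take_append_of_le_length hi.le]
  · cases b <;> simp

theorem length_coarea (P : Path) : (coarea P).length = P.count true := by
  induction P using List.reverseRecOn with
  | nil => rfl
  | append_singleton P b ih => cases b <;> simp [coarea_append_singleton, ih]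

theorem count_false_mem_coarea (Q R : Path) : Q.count false ∈ coarea (Q ++ true :: R) := by
  simp only [coarea, List.mem_filterMap, List.mem_range]
  exact ⟨Q.length, by simp, by simp⟩

theorem exists_notMem_coarea {P : Path} (h0 : 0 ∈ coarea P) :
    ∃ i, 1 ≤ i ∧ i ≤ P.count true ∧ i ∉ coarea P := by
  by_contra! h
  have hsub : Finset.range (P.count true + 1) ⊆ (coarea P).toFinset := by
    intro i hi
    rw [List.mem_toFinset]
    rcases i.eq_zero_or_pos with rfl | hpos
    · exact h0
    · exact h i hpos (Nat.lt_succ_iff.mp (Finset.mem_range.mp hi))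
  have hcard := (Finset.card_le_card hsub).trans (List.toFinset_card_le _)
  rw [Finset.card_range, length_coarea] at hcard
  omega

theorem le_runStat {P : Path} {r : ℕ} (h0 : 0 ∈ coarea P) (h : ∀ i < r, i ∈ coarea P) :
    r ≤ runStat P :=
  le_csInf (exists_notMem_coarea h0) fun i hi =>
    not_lt.mp fun hlt => hi.2.2 (h i hlt)

theorem IsDyck.prefRank_nonneg {m n : ℕ} {Q R : Path} (h : IsDyck m n (Q ++ R)) :
    0 ≤ prefRank m n Q := by
  simpa using h.2.2 Q.length (by simp)

theorem prefRank_zigzag {m n : ℕ} (hmn : n < m) (i : ℕ) :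
    prefRank m n (zigzag i) = (i * (m - n) : ℕ) := by
  rw [prefRank, count_zigzag, count_zigzag, Nat.cast_mul, Nat.cast_sub hmn.le]
  ring

theorem IsDyck.eq_true_cons_of_zigzag_append {m n i : ℕ} (hmn : n < m) {R : Path}
    (hP : IsDyck m n (zigzag i ++ R)) (hin : i * (m - n) < n) : ∃ Q, R = true :: Q := by
  match R with
  | [] =>
    have h := hP.1
    rw [List.append_nil, count_zigzag] at h
    have := Nat.le_mul_of_pos_right i (Nat.sub_pos_of_lt hmn)
    omega
  | true :: Q => exact ⟨Q, rfl⟩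
  | false :: Q =>
    rw [List.append_cons] at hP
    have h := hP.prefRank_nonneg
    have h' := prefRank_zigzag hmn i
    simp only [prefRank, List.count_append, List.count_cons, List.count_nil, count_zigzag]
      at h h'
    push_cast at h
    norm_num at h
    have : ((i * (m - n) : ℕ) : ℤ) < n := by exact_mod_cast hin
    linarith

/-- A Dyck path whose first `i` vertical runs have length one starts with `(NE)^i N`,
as long as `i (m - n) < n`. -/
theorem IsDyck.exists_eq_zigzag_append {m n : ℕ} (hmn : n < m) {P : Path}
    (hP : IsDyck m n P) {i : ℕ} (hi : i ≤ iones (compType P)) (hin : i * (m - n) < n) :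
    ∃ Q, P = zigzag i ++ true :: Q := by
  suffices ∃ R, P = zigzag i ++ R by
    obtain ⟨R, rfl⟩ := this
    obtain ⟨Q, rfl⟩ := hP.eq_true_cons_of_zigzag_append hmn hin
    exact ⟨Q, rfl⟩
  induction i with
  | zero => exact ⟨P, rfl⟩
  | succ i ih =>
    rw [Nat.succ_mul] at hin
    obtain ⟨R, rfl⟩ := ih (by omega) (by omega)
    obtain ⟨Q, rfl⟩ := hP.eq_true_cons_of_zigzag_append hmn (by omega)
    rw [iones_compType_zigzag_append] at hi
    match Q with
    | [] =>
      have h := hP.1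
      simp [count_zigzag] at h
      have := Nat.le_mul_of_pos_right i (Nat.sub_pos_of_lt hmn)
      omega
    | true :: Q =>
      rw [iones_compType_true_true] at hi
      omega
    | false :: Q => exact ⟨Q, by simp [zigzag_succ]⟩

theorem le_retStat {m n r : ℕ} (hmn : n < m) {P : Path}
    (h : ∀ i < r, i * (m - n) < n ∧ ∃ Q, P = zigzag i ++ true :: Q) : r ≤ retStat m n P := by
  have hnodup : ((List.range r).map (2 * ·)).Nodup :=
    List.nodup_range.map (mul_right_injective₀ two_ne_zero)
  have hsub : ∀ l : List ℕ, (List.range r).map (2 * ·) ⊆ l → r ≤ l.length := fun l hl => by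
    simpa only [List.length_map, List.length_range] using
      (List.subperm_of_subset hnodup hl).length_le
  apply hsub
  intro j hj
  obtain ⟨i, hi, rfl⟩ := List.mem_map.mp hj
  obtain ⟨hin, Q, rfl⟩ := h i (List.mem_range.mp hi)
  rw [List.mem_filter, ← length_zigzag i, List.take_left, prefRank_zigzag hmn]
  exact ⟨by simp, by simpa only [decide_eq_true_eq] using Nat.cast_lt.mpr hin⟩

/-- For `m > n` and `P ∈ D_{m,n}`,
`rr(comp(P), m) = min(Iones(comp(P)) + 1, ⌈n/(m-n)⌉) ≤ min(ret(P), run(P))`. -/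
theorem rr_le_min_ret_run (m n : ℕ) (hn : 0 < n) (hmn : n < m) (P : Path)
    (hP : IsDyck m n P) :
    rr m (compType P) ≤ retStat m n P ∧ rr m (compType P) ≤ runStat P := by
  have hones : ∀ i < rr m (compType P),
      i * (m - n) < n ∧ ∃ Q, P = zigzag i ++ true :: Q := by
    intro i hi
    rw [rr, sum_compType, hP.2.1, lt_min_iff] at hi
    have hin : i * (m - n) < n := by
      have h := (Nat.le_div_iff_mul_le (Nat.sub_pos_of_lt hmn)).mp hi.2
      rw [Nat.succ_mul] at h
      omega
    exact ⟨hin, hP.exists_eq_zigzag_append hmn (Nat.lt_succ_iff.mp hi.1) hin⟩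
  have hmem : ∀ i, (∃ Q, P = zigzag i ++ true :: Q) → i ∈ coarea P := by
    rintro i ⟨Q, rfl⟩
    simpa only [count_zigzag] using count_false_mem_coarea (zigzag i) Q
  exact ⟨le_retStat hmn hones,
    le_runStat (hmem 0 (hP.exists_eq_zigzag_append hmn (Nat.zero_le _) (by omega)))
      fun i hi => hmem i (hones i hi).2⟩

end RationalDyck
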